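/- Let λ > 0 and σ_v > 0, and set a = −λσ_v and y(κ) = −(κ + λσ_v²)/σ_v. Then for every κ ∈ ℝ, ∫_{−∞}^{κ} g(t) dt = 1 + exp(−a²/2) · [ exp(a·y(κ)) Φ(y(κ)) − exp(a²/2) Φ(y(κ) − a) ], where g is the exponential composed error density. -/

import Mathlib

open Real MeasureTheory

/-- Standard normal density. -/
noncomputable def stdNormalPdf (x : ℝ) : ℝ := Real.exp (-x ^ 2 / 2) / Real.sqrt (2 * Real.pi)

/-- Standard normal cumulative distribution function. -/
noncomputable def stdNormalCdf (x : ℝ) : ℝ := ∫ t in Set.Iic x, stdNormalPdf t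

/-- Exponential composed error density. -/
noncomputable def expComposedErrorPdf (lam σv t : ℝ) : ℝ :=
  lam * Real.exp (lam * t + σv ^ 2 * lam ^ 2 / 2) * stdNormalCdf (-t / σv - lam * σv)

theorem stdNormalPdf_eq_gaussianPDFReal :
    stdNormalPdf = ProbabilityTheory.gaussianPDFReal 0 1 := by
  funext x
  simp [stdNormalPdf, ProbabilityTheory.gaussianPDFReal, div_eq_inv_mul]

theorem integrable_stdNormalPdf : Integrable stdNormalPdf := by
  rw [stdNormalPdf_eq_gaussianPDFReal]
  exact ProbabilityTheory.integrable_gaussianPDFReal 0 1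

theorem integral_stdNormalPdf : ∫ x, stdNormalPdf x = 1 := by
  rw [stdNormalPdf_eq_gaussianPDFReal]
  exact ProbabilityTheory.integral_gaussianPDFReal_eq_one 0 one_ne_zero

theorem stdNormalPdf_nonneg (x : ℝ) : 0 ≤ stdNormalPdf x := by
  unfold stdNormalPdf
  positivity

theorem continuous_stdNormalPdf : Continuous stdNormalPdf := by
  unfold stdNormalPdf
  fun_prop

theorem stdNormalPdf_sub (x c : ℝ) :
    stdNormalPdf (x - c) = Real.exp (c * x - c ^ 2 / 2) * stdNormalPdf x := by
  unfold stdNormalPdf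
  rw [← mul_div_assoc, ← Real.exp_add]
  ring_nf

theorem stdNormalCdf_nonneg (x : ℝ) : 0 ≤ stdNormalCdf x :=
  integral_nonneg stdNormalPdf_nonneg

theorem stdNormalCdf_le_one (x : ℝ) : stdNormalCdf x ≤ 1 := by
  rw [← integral_stdNormalPdf]
  exact setIntegral_le_integral integrable_stdNormalPdf (ae_of_all _ stdNormalPdf_nonneg)

theorem hasDerivAt_stdNormalCdf (x : ℝ) : HasDerivAt stdNormalCdf (stdNormalPdf x) x := by
  have h : stdNormalCdf = fun u => stdNormalCdf 0 + ∫ t in (0 : ℝ)..u, stdNormalPdf t := by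
    funext u
    rw [← intervalIntegral.integral_Iic_sub_Iic integrable_stdNormalPdf.integrableOn
      integrable_stdNormalPdf.integrableOn]
    simp [stdNormalCdf]
  rw [h]
  exact (continuous_stdNormalPdf.integral_hasStrictDerivAt 0 x).hasDerivAt.const_add _

theorem continuous_stdNormalCdf : Continuous stdNormalCdf :=
  continuous_iff_continuousAt.2 fun x => (hasDerivAt_stdNormalCdf x).continuousAt

theorem tendsto_stdNormalCdf_atTop : Filter.Tendsto stdNormalCdf Filter.atTop (nhds 1) := by
  rw [← integral_stdNormalPdf]
  exact (aecover_Iic Filter.tendsto_id).integral_tendsto_of_countably_generated integrable_stdNormalPdf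

theorem integrableOn_Iic_expComposedErrorPdf {lam : ℝ} (hlam : 0 < lam) (σv κ : ℝ) :
    IntegrableOn (expComposedErrorPdf lam σv) (Set.Iic κ) := by
  have hexp : IntegrableOn (fun t => lam * Real.exp (lam * t + σv ^ 2 * lam ^ 2 / 2))
      (Set.Iic κ) := by
    simp_rw [Real.exp_add]
    exact ((integrableOn_exp_mul_Iic hlam κ).mul_const _).const_mul lam
  refine hexp.mul_bdd (c := 1) ?_ (ae_of_all _ fun t => ?_)
  · exact (continuous_stdNormalCdf.comp (by fun_prop)).aestronglyMeasurable
  · rw [Real.norm_of_nonneg (stdNormalCdf_nonneg _)]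
    exact stdNormalCdf_le_one _

/-- An antiderivative of the exponential composed error density, vanishing at `-∞`. -/
noncomputable def expComposedErrorCdf (lam σv t : ℝ) : ℝ :=
  1 - stdNormalCdf (-t / σv) +
    Real.exp (lam * t + σv ^ 2 * lam ^ 2 / 2) * stdNormalCdf (-t / σv - lam * σv)

theorem hasDerivAt_expComposedErrorCdf (lam : ℝ) {σv : ℝ} (hσv : σv ≠ 0) (t : ℝ) :
    HasDerivAt (expComposedErrorCdf lam σv) (expComposedErrorPdf lam σv t) t := by
  have hz : HasDerivAt (fun t : ℝ => -t / σv) (-1 / σv) t := (hasDerivAt_id t).neg.div_const σv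
  have hΦ := (hasDerivAt_stdNormalCdf (-t / σv)).comp t hz
  have hΦ' := (hasDerivAt_stdNormalCdf (-t / σv - lam * σv)).comp t (hz.sub_const (lam * σv))
  have he : HasDerivAt (fun t : ℝ => Real.exp (lam * t + σv ^ 2 * lam ^ 2 / 2))
      (Real.exp (lam * t + σv ^ 2 * lam ^ 2 / 2) * (lam * 1)) t :=
    (((hasDerivAt_id t).const_mul lam).add_const _).exp
  convert! (hΦ.const_sub 1).add (he.mul hΦ') using 1
  have hpdf : Real.exp (lam * t + σv ^ 2 * lam ^ 2 / 2) * stdNormalPdf (-t / σv - lam * σv)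
      = stdNormalPdf (-t / σv) := by
    have harg : lam * t + σv ^ 2 * lam ^ 2 / 2 +
        (lam * σv * (-t / σv) - (lam * σv) ^ 2 / 2) = 0 := by
      field_simp
      ring
    rw [stdNormalPdf_sub, ← mul_assoc, ← Real.exp_add, harg, Real.exp_zero, one_mul]
  simp only [expComposedErrorPdf, Function.comp_apply]
  linear_combination (1 / σv) * hpdf

theorem tendsto_expComposedErrorCdf_atBot {lam σv : ℝ} (hlam : 0 < lam) (hσv : 0 < σv) :
    Filter.Tendsto (expComposedErrorCdf lam σv) Filter.atBot (nhds 0) := by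
  have hz : Filter.Tendsto (fun t : ℝ => -t / σv) Filter.atBot Filter.atTop :=
    Filter.tendsto_neg_atBot_atTop.atTop_div_const hσv
  have hΦ := tendsto_stdNormalCdf_atTop.comp hz
  have hΦ' := tendsto_stdNormalCdf_atTop.comp
    (Filter.tendsto_atTop_add_const_right _ (-(lam * σv)) hz)
  have he : Filter.Tendsto (fun t : ℝ => Real.exp (lam * t + σv ^ 2 * lam ^ 2 / 2))
      Filter.atBot (nhds 0) :=
    Real.tendsto_exp_atBot.comp
      (Filter.tendsto_atBot_add_const_right _ _ (Filter.tendsto_id.const_mul_atBot hlam))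
  simpa [expComposedErrorCdf, Function.comp_def, sub_eq_add_neg] using!
    (hΦ.const_sub 1).add (he.mul hΦ')

theorem stmt4 (lam σv : ℝ) (hlam : 0 < lam) (hσv : 0 < σv)
    (a : ℝ) (ha : a = -(lam * σv))
    (y : ℝ → ℝ) (hy : ∀ κ, y κ = -((κ + lam * σv ^ 2) / σv))
    (κ : ℝ) :
    (∫ t in Set.Iic κ, expComposedErrorPdf lam σv t) =
      1 + Real.exp (-a ^ 2 / 2) *
        (Real.exp (a * y κ) * stdNormalCdf (y κ)
          - Real.exp (a ^ 2 / 2) * stdNormalCdf (y κ - a)) := by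
  rw [integral_Iic_of_hasDerivAt_of_tendsto'
    (fun t _ => hasDerivAt_expComposedErrorCdf lam hσv.ne' t)
    (integrableOn_Iic_expComposedErrorPdf hlam σv κ)
    (tendsto_expComposedErrorCdf_atBot hlam hσv), sub_zero, expComposedErrorCdf]
  have hy₁ : y κ = -κ / σv - lam * σv := by
    rw [hy]
    field_simp
    ring
  have hy₂ : y κ - a = -κ / σv := by
    rw [hy₁, ha]
    ring
  have harg : -a ^ 2 / 2 + a * y κ = lam * κ + σv ^ 2 * lam ^ 2 / 2 := by
    rw [hy₁, ha]
    field_simp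
    ring
  rw [hy₂, mul_sub, ← mul_assoc, ← mul_assoc, ← Real.exp_add, ← Real.exp_add, harg, hy₁,
    show -a ^ 2 / 2 + a ^ 2 / 2 = 0 by ring, Real.exp_zero]
  ring
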